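/- For every finite connected graph G, every vertex w, and every BFS-tree T of G rooted at w, the rooted insize equals the rooted thinness: ρ_{w,T}(G) = μ_{w,T}(G). -/

import Mathlib

open SimpleGraph

noncomputable section

namespace HypPaper

variable {V : Type*}

/-- Gromov product `(y|z)_w = (d(y,w)+d(z,w)-d(y,z))/2`. -/
def gp (G : SimpleGraph V) (y z w : V) : ℝ :=
  ((G.dist y w : ℝ) + (G.dist z w : ℝ) - (G.dist y z : ℝ)) / 2

/-- `G` is `δ`-hyperbolic. -/
def IsDeltaHyp (G : SimpleGraph V) (δ : ℝ) : Prop :=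
  ∀ w x y z : V, gp G x y w ≥ min (gp G x z w) (gp G y z w) - δ

/-- The hyperbolicity `δ(G)`: least `δ ≥ 0` such that `G` is `δ`-hyperbolic. -/
def hyperbolicity (G : SimpleGraph V) : ℝ :=
  sInf {δ : ℝ | 0 ≤ δ ∧ IsDeltaHyp G δ}

/-- Pointed hyperbolicity `δ_w(G)` with respect to basepoint `w`. -/
def pointedHyp (G : SimpleGraph V) (w : V) : ℝ :=
  sInf {δ : ℝ | ∀ x y z : V, gp G x y w ≥ min (gp G x z w) (gp G y z w) - δ}

/-- A walk is a geodesic (shortest path) if its length equals the distance. -/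
def IsGeodesic (G : SimpleGraph V) {x y : V} (p : G.Walk x y) : Prop :=
  p.length = G.dist x y

/-- Thinness condition at corner `v` of a triangle, with sides `p : v → u` and `q : v → u'`. -/
def ThinCorner (G : SimpleGraph V) (δ : ℝ) {v u u' : V}
    (p : G.Walk v u) (q : G.Walk v u') : Prop :=
  ∀ a ∈ p.support, ∀ b ∈ q.support,
    G.dist v a = G.dist v b → (G.dist v a : ℝ) ≤ gp G u u' v →
    (G.dist a b : ℝ) ≤ δ

/-- A geodesic triangle with sides `p : x → y`, `q : y → z`, `r : z → x` is `δ`-thin. -/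
def TriangleThin (G : SimpleGraph V) (δ : ℝ) {x y z : V}
    (p : G.Walk x y) (q : G.Walk y z) (r : G.Walk z x) : Prop :=
  ThinCorner G δ p r.reverse ∧ ThinCorner G δ q p.reverse ∧ ThinCorner G δ r q.reverse

/-- Thinness `τ(G)`: least `δ` such that every geodesic triangle is `δ`-thin. -/
def thinness (G : SimpleGraph V) : ℝ :=
  sInf {δ : ℝ | ∀ (x y z : V) (p : G.Walk x y) (q : G.Walk y z) (r : G.Walk z x),
    IsGeodesic G p → IsGeodesic G q → IsGeodesic G r → TriangleThin G δ p q r}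

/-- The insize `max {d(y_z,z_y), d(z_x,x_z), d(x_y,y_x)}` of a geodesic triangle with
sides `p : x → y`, `q : y → z`, `r : z → x`. -/
def triInsize (G : SimpleGraph V) {x y z : V}
    (p : G.Walk x y) (q : G.Walk y z) (r : G.Walk z x) : ℝ :=
  max (G.dist (p.getVert ⌊gp G y z x⌋₊) (r.reverse.getVert ⌊gp G y z x⌋₊) : ℝ)
    (max (G.dist (q.getVert ⌊gp G z x y⌋₊) (p.reverse.getVert ⌊gp G z x y⌋₊) : ℝ)
      (G.dist (r.getVert ⌊gp G x y z⌋₊) (q.reverse.getVert ⌊gp G x y z⌋₊) : ℝ))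

/-- Insize `ι(G)`: least upper bound on insizes of geodesic triangles. -/
def insize (G : SimpleGraph V) : ℝ :=
  sInf {δ : ℝ | ∀ (x y z : V) (p : G.Walk x y) (q : G.Walk y z) (r : G.Walk z x),
    IsGeodesic G p → IsGeodesic G q → IsGeodesic G r → triInsize G p q r ≤ δ}

/-- A geodesic triangle with sides `p : x → y`, `q : y → z`, `r : z → x` is `δ`-slim. -/
def TriangleSlim (G : SimpleGraph V) (δ : ℝ) {x y z : V}
    (p : G.Walk x y) (q : G.Walk y z) (r : G.Walk z x) : Prop :=
  (∀ a ∈ p.support, ∃ b, (b ∈ q.support ∨ b ∈ r.support) ∧ (G.dist a b : ℝ) ≤ δ) ∧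
  (∀ a ∈ q.support, ∃ b, (b ∈ r.support ∨ b ∈ p.support) ∧ (G.dist a b : ℝ) ≤ δ) ∧
  (∀ a ∈ r.support, ∃ b, (b ∈ p.support ∨ b ∈ q.support) ∧ (G.dist a b : ℝ) ≤ δ)

/-- Slimness `ς(G)`: least `δ` such that every geodesic triangle is `δ`-slim. -/
def slimness (G : SimpleGraph V) : ℝ :=
  sInf {δ : ℝ | ∀ (x y z : V) (p : G.Walk x y) (q : G.Walk y z) (r : G.Walk z x),
    IsGeodesic G p → IsGeodesic G q → IsGeodesic G r → TriangleSlim G δ p q r}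

/-- The metric interval `I(u,v)`. -/
def interval (G : SimpleGraph V) (u v : V) : Set V :=
  {x | G.dist u x + G.dist x v = G.dist u v}

/-- Interval thinness `κ(G)`. -/
def intervalThinness (G : SimpleGraph V) : ℝ :=
  sInf {κ : ℝ | ∀ x y a b : V, a ∈ interval G x y → b ∈ interval G x y →
    G.dist x a = G.dist x b → (G.dist a b : ℝ) ≤ κ}

/-- A BFS-tree of `G` rooted at `w`: a spanning tree (encoded by its parent function)
in which the path from `w` to any vertex is a shortest path of `G`. -/
structure BFSTree (G : SimpleGraph V) (w : V) where
  parent : V → V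
  parent_root : parent w = w
  adj_parent : ∀ x, x ≠ w → G.Adj (parent x) x
  dist_parent : ∀ x, x ≠ w → G.dist w (parent x) + 1 = G.dist w x

/-- The vertex of the tree path `[w,x]_T` at distance `r` from the root `w`
(for `r ≤ d(w,x)`). -/
def treeVert (G : SimpleGraph V) {w : V} (T : BFSTree G w) (x : V) (r : ℕ) : V :=
  T.parent^[G.dist w x - r] x

/-- `v` lies on the tree path `[w,x]_T`. -/
def onRootPath (G : SimpleGraph V) {w : V} (T : BFSTree G w) (x v : V) : Prop :=
  ∃ i ≤ G.dist w x, v = T.parent^[i] x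

/-- The rooted insize `ρ_{w,T}(G) = max {d(x_y, y_x) : x, y ∈ V}`, where `x_y`, `y_x` are
the vertices of `[w,x]_T`, `[w,y]_T` at distance `⌊(x|y)_w⌋` from `w`. -/
def rootedInsize (G : SimpleGraph V) {w : V} (T : BFSTree G w) : ℝ :=
  sSup {ρ : ℝ | ∃ x y : V,
    ρ = (G.dist (treeVert G T x ⌊gp G x y w⌋₊) (treeVert G T y ⌊gp G x y w⌋₊) : ℝ)}

/-- The rooted thinness `μ_{w,T}(G)`. -/
def rootedThinness (G : SimpleGraph V) {w : V} (T : BFSTree G w) : ℝ :=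
  sSup {μ : ℝ | ∃ x y x' y' : V, onRootPath G T x x' ∧ onRootPath G T y y' ∧
    G.dist w x' = G.dist w y' ∧ (G.dist w x' : ℝ) ≤ gp G x y w ∧
    μ = (G.dist x' y' : ℝ)}


namespace BFSTree

variable {G : SimpleGraph V} {w : V}

theorem dist_parent_iterate (T : BFSTree G w) {x : V} {i : ℕ} (hi : i ≤ G.dist w x) :
    G.dist w (T.parent^[i] x) + i = G.dist w x := by
  induction i with
  | zero => simp
  | succ n ih =>
    have h := ih (by omega)
    have hne : T.parent^[n] x ≠ w := by
      intro hw
      rw [hw, SimpleGraph.dist_self] at h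
      omega
    have h' := T.dist_parent _ hne
    rw [Function.iterate_succ_apply']
    omega

theorem dist_treeVert (T : BFSTree G w) {x : V} {r : ℕ} (hr : r ≤ G.dist w x) :
    G.dist w (treeVert G T x r) = r := by
  have h := T.dist_parent_iterate (x := x) (i := G.dist w x - r) (by omega)
  unfold treeVert
  omega

theorem onRootPath_treeVert (T : BFSTree G w) (x : V) (r : ℕ) :
    onRootPath G T x (treeVert G T x r) :=
  ⟨_, Nat.sub_le _ _, rfl⟩

theorem treeVert_dist_of_onRootPath (T : BFSTree G w) {x v : V} (h : onRootPath G T x v) :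
    treeVert G T x (G.dist w v) = v := by
  obtain ⟨i, hi, rfl⟩ := h
  have h := T.dist_parent_iterate hi
  unfold treeVert
  congr 2
  omega

end BFSTree

theorem gp_comm (G : SimpleGraph V) (x y w : V) : gp G x y w = gp G y x w := by
  unfold gp
  rw [SimpleGraph.dist_comm (u := x) (v := y)]
  ring

theorem gp_nonneg {G : SimpleGraph V} (hG : G.Connected) (x y w : V) : 0 ≤ gp G x y w := by
  have h : (G.dist x y : ℝ) ≤ G.dist x w + G.dist w y := by
    exact_mod_cast hG.dist_triangle
  rw [SimpleGraph.dist_comm (u := w)] at h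
  unfold gp
  linarith

theorem gp_le_dist_left {G : SimpleGraph V} (hG : G.Connected) (x y w : V) :
    gp G x y w ≤ G.dist w x := by
  have h : (G.dist y w : ℝ) ≤ G.dist y x + G.dist x w := by
    exact_mod_cast hG.dist_triangle
  unfold gp
  rw [SimpleGraph.dist_comm (u := w), SimpleGraph.dist_comm (u := x) (v := y)]
  linarith

theorem floor_gp_le_dist_left {G : SimpleGraph V} (hG : G.Connected) (x y w : V) :
    ⌊gp G x y w⌋₊ ≤ G.dist w x :=
  Nat.floor_le_of_le (gp_le_dist_left hG x y w)

theorem floor_gp_le_dist_right {G : SimpleGraph V} (hG : G.Connected) (x y w : V) :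
    ⌊gp G x y w⌋₊ ≤ G.dist w y :=
  gp_comm G x y w ▸ floor_gp_le_dist_left hG y x w

theorem gp_le_gp_parent_add_one {G : SimpleGraph V} (hG : G.Connected) {w : V} (T : BFSTree G w)
    {x : V} (hx : x ≠ w) (y : V) : gp G x y w ≤ gp G (T.parent x) y w + 1 := by
  have h₁ : (G.dist w (T.parent x) : ℝ) + 1 = G.dist w x := by
    exact_mod_cast T.dist_parent x hx
  have h₂ : (G.dist (T.parent x) y : ℝ) ≤ G.dist (T.parent x) x + G.dist x y := by
    exact_mod_cast hG.dist_triangle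
  have h₃ : G.dist (T.parent x) x = 1 := SimpleGraph.dist_eq_one_iff_adj.mpr (T.adj_parent x hx)
  rw [h₃, Nat.cast_one] at h₂
  unfold gp
  rw [SimpleGraph.dist_comm (u := x) (v := w), SimpleGraph.dist_comm (u := T.parent x) (v := w)]
  linarith

/-- Moving `x` towards a vertex `v` of its root path changes `(x|y)_w` by at most one at each
step, so the floor of the product attains `d(w,v)` on the way. -/
theorem exists_onRootPath_floor_gp_eq {G : SimpleGraph V} (hG : G.Connected) {w : V}
    (T : BFSTree G w) {x y v : V} (hv : onRootPath G T x v) (h : (G.dist w v : ℝ) ≤ gp G x y w) :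
    ∃ u, onRootPath G T u v ∧ ⌊gp G u y w⌋₊ = G.dist w v := by
  obtain ⟨i, hi, rfl⟩ := hv
  induction i generalizing x with
  | zero =>
    refine ⟨x, ⟨0, hi, rfl⟩, le_antisymm (floor_gp_le_dist_left hG x y w) (Nat.le_floor h)⟩
  | succ n ih =>
    by_cases hlt : gp G x y w < G.dist w (T.parent^[n + 1] x) + 1
    · exact ⟨x, ⟨n + 1, hi, rfl⟩, (Nat.floor_eq_iff (gp_nonneg hG x y w)).mpr ⟨h, hlt⟩⟩
    · have hx : x ≠ w := by
        rintro rfl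
        simp at hi
      have hd := T.dist_parent x hx
      have hstep := gp_le_gp_parent_add_one hG T hx y
      rw [Function.iterate_succ_apply] at hlt ⊢
      exact ih (by omega) (by linarith)

/-- The rooted insize equals the rooted thinness: `ρ_{w,T}(G) = μ_{w,T}(G)`. -/
theorem rootedInsize_eq_rootedThinness
    {V : Type*} [Fintype V] (G : SimpleGraph V) (hG : G.Connected)
    (w : V) (T : BFSTree G w) :
    rootedInsize G T = rootedThinness G T := by
  unfold rootedInsize rootedThinness
  congr 1
  ext d
  constructor
  · rintro ⟨x, y, rfl⟩
    have hx := T.dist_treeVert (floor_gp_le_dist_left hG x y w)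
    have hy := T.dist_treeVert (floor_gp_le_dist_right hG x y w)
    refine ⟨x, y, _, _, T.onRootPath_treeVert _ _, T.onRootPath_treeVert _ _,
      hx.trans hy.symm, ?_, rfl⟩
    rw [hx]
    exact Nat.floor_le (gp_nonneg hG x y w)
  · rintro ⟨x, y, x', y', hx, hy, hxy, hle, rfl⟩
    obtain ⟨u, hu, hfloor⟩ := exists_onRootPath_floor_gp_eq hG T hx hle
    refine ⟨u, y, ?_⟩
    rw [hfloor, T.treeVert_dist_of_onRootPath hu, hxy, T.treeVert_dist_of_onRootPath hy]

end HypPaper
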